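/- arXiv:2510.20690 — 2 statements merged into one kernel-verified Lean document; each statement's English description precedes it below -/
import Mathlib

section
/- Let ρ₀ ∈ [0, 1), β > 0, γ > 0, and define ρ(P) = ρ₀ + β(P − 1)^γ and g(P) = (1 − ρ(P))/P + ρ(P) for real P > 1. Then g′(P) → −(1 − ρ₀) < 0 as P → 1⁺; in particular, there exists δ > 0 such that g′(P) < 0, and hence g is strictly decreasing, on the interval (1, 1 + δ). -/
open Filter

/-- Rising correlation model: ρ(P) = ρ₀ + β(P − 1)^γ (real exponent). -/
noncomputable def rhoFun (ρ₀ β γ P : ℝ) : ℝ := ρ₀ + β * (P - 1) ^ γ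

/-- Unnormalized variance factor: g(P) = (1 − ρ(P))/P + ρ(P). -/
noncomputable def gFun (ρ₀ β γ P : ℝ) : ℝ :=
  (1 - rhoFun ρ₀ β γ P) / P + rhoFun ρ₀ β γ P

/-- g′(P) = ρ′(P)(1 − 1/P) − (1 − ρ(P))/P² with ρ′(P) = βγ(P − 1)^{γ−1}. -/
noncomputable def gDeriv (ρ₀ β γ P : ℝ) : ℝ :=
  β * γ * (P - 1) ^ (γ - 1) * (1 - 1 / P) - (1 - rhoFun ρ₀ β γ P) / P ^ 2

theorem gDeriv_eq_of_one_lt {ρ₀ β γ P : ℝ} (hP : 1 < P) :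
    gDeriv ρ₀ β γ P
      = β * γ * (P - 1) ^ γ / P - (1 - (ρ₀ + β * (P - 1) ^ γ)) / P ^ 2 := by
  have hP1 : 0 < P - 1 := sub_pos.2 hP
  have hP0 : P ≠ 0 := by positivity
  rw [gDeriv, rhoFun, Real.rpow_sub_one hP1.ne']
  field_simp

theorem hasDerivAt_gFun {ρ₀ β γ P : ℝ} (hP : 1 < P) :
    HasDerivAt (gFun ρ₀ β γ) (gDeriv ρ₀ β γ P) P := by
  have hP1 : P - 1 ≠ 0 := (sub_pos.2 hP).ne'
  have hP0 : P ≠ 0 := by positivity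
  have hρ : HasDerivAt (rhoFun ρ₀ β γ) (β * (1 * γ * (P - 1) ^ (γ - 1))) P :=
    ((((hasDerivAt_id P).sub_const 1).rpow_const (Or.inl hP1)).const_mul β).const_add ρ₀
  refine (((hρ.const_sub 1).div (hasDerivAt_id P) hP0).add hρ).congr_deriv ?_
  simp only [gDeriv, id]
  field_simp
  ring

theorem tendsto_gDeriv_one {ρ₀ β γ : ℝ} (hγ : 0 < γ) :
    Tendsto (gDeriv ρ₀ β γ) (nhdsWithin 1 (Set.Ioi 1)) (nhds (-(1 - ρ₀))) := by
  have hpow : ContinuousAt (fun P : ℝ => (P - 1) ^ γ) 1 :=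
    (continuousAt_id.sub continuousAt_const).rpow_const (Or.inr hγ.le)
  have hcont : ContinuousAt (fun P : ℝ =>
      β * γ * (P - 1) ^ γ / P - (1 - (ρ₀ + β * (P - 1) ^ γ)) / P ^ 2) 1 :=
    ((continuousAt_const.mul hpow).div continuousAt_id one_ne_zero).sub
      ((continuousAt_const.sub (continuousAt_const.add (continuousAt_const.mul hpow))).div
        (continuousAt_id.pow 2) (by simp))
  have hlim := hcont.tendsto.mono_left (nhdsWithin_le_nhds (s := Set.Ioi 1))
  simp only [sub_self, Real.zero_rpow hγ.ne', mul_zero, add_zero, one_pow, div_one,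
    zero_sub] at hlim
  exact hlim.congr' (eventually_nhdsWithin_of_forall fun P hP => (gDeriv_eq_of_one_lt hP).symm)

/-- **Near P = 1 the variance factor decreases:** g′(P) → −(1 − ρ₀) < 0 as P → 1⁺,
so g′ < 0 and g is strictly decreasing on some interval (1, 1 + δ). -/
theorem gFun_decreasing_near_one (ρ₀ β γ : ℝ) (hρ₀ : ρ₀ ∈ Set.Ico (0 : ℝ) 1)
    (hβ : 0 < β) (hγ : 0 < γ) :
    Tendsto (gDeriv ρ₀ β γ) (nhdsWithin 1 (Set.Ioi 1)) (nhds (-(1 - ρ₀))) ∧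
    -(1 - ρ₀) < 0 ∧
    ∃ δ > (0 : ℝ),
      (∀ P ∈ Set.Ioo (1 : ℝ) (1 + δ), gDeriv ρ₀ β γ P < 0) ∧
      StrictAntiOn (gFun ρ₀ β γ) (Set.Ioo (1 : ℝ) (1 + δ)) := by
  have hneg : -(1 - ρ₀) < 0 := by linarith [hρ₀.2]
  have hlim : Tendsto (gDeriv ρ₀ β γ) (nhdsWithin 1 (Set.Ioi 1)) (nhds (-(1 - ρ₀))) :=
    tendsto_gDeriv_one hγ
  obtain ⟨u, hu, hsub⟩ := mem_nhdsGT_iff_exists_Ioo_subset.1 (hlim.eventually_lt_const hneg)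
  have hderiv : ∀ P ∈ Set.Ioo (1 : ℝ) (1 + (u - 1)), gDeriv ρ₀ β γ P < 0 := fun P hP =>
    hsub (by simpa using hP)
  refine ⟨hlim, hneg, u - 1, sub_pos.2 hu, hderiv, ?_⟩
  refine strictAntiOn_of_deriv_neg (convex_Ioo _ _)
    (fun P hP => (hasDerivAt_gFun hP.1).continuousAt.continuousWithinAt) fun P hP => ?_
  rw [interior_Ioo] at hP
  rw [(hasDerivAt_gFun hP.1).deriv]
  exact hderiv P hP
end

section
/- Let ρ₀ ∈ [0, 1), β > 0, γ ≥ 1, and define ρ(P) = ρ₀ + β(P − 1)^γ and g(P) = (1 − ρ(P))/P + ρ(P) for real P > 1. Then there exists a unique P⋆ ∈ (1, ∞) such that g is strictly decreasing on (1, P⋆] and strictly increasing on [P⋆, ∞); in particular, P⋆ is the unique minimizer of g on (1, ∞). -/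
theorem gFun_hasDerivAt (ρ₀ β γ : ℝ) {P : ℝ} (hP : 1 < P) :
    HasDerivAt (gFun ρ₀ β γ)
      ((β * ((P - 1) ^ γ * (γ * (P - 1) + (γ + 1))) - (1 - ρ₀)) / P ^ 2) P := by
  have ht : 0 < P - 1 := sub_pos.2 hP
  have hP0 : P ≠ 0 := by positivity
  have hρ : HasDerivAt (rhoFun ρ₀ β γ) (β * (1 * γ * (P - 1) ^ (γ - 1))) P :=
    ((((hasDerivAt_id P).sub_const 1).rpow_const (Or.inl ht.ne')).const_mul β).const_add ρ₀
  have hg : HasDerivAt (gFun ρ₀ β γ) _ P :=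
    ((hρ.const_sub 1).div (hasDerivAt_id P) hP0).add hρ
  convert hg using 1
  simp only [rhoFun, id, Real.rpow_sub_one ht.ne']
  field_simp
  ring

theorem gFun_continuousOn (ρ₀ β : ℝ) {γ : ℝ} (hγ : 0 ≤ γ) :
    ContinuousOn (gFun ρ₀ β γ) (Set.Ioi 0) := by
  have hρ : Continuous (rhoFun ρ₀ β γ) :=
    continuous_const.add
      (continuous_const.mul ((continuous_id.sub continuous_const).rpow_const fun _ => Or.inr hγ))
  exact ((continuous_const.sub hρ).continuousOn.div continuousOn_id
    fun x hx => (Set.mem_Ioi.1 hx).ne').add hρ.continuousOn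

/-- The increasing part of the numerator of the derivative of `gFun`, in the variable `P - 1`. -/
theorem rpow_mul_linear_strictMonoOn {γ : ℝ} (hγ : 0 < γ) :
    StrictMonoOn (fun t : ℝ => t ^ γ * (γ * t + (γ + 1))) (Set.Ici 0) := by
  intro a ha b hb hab
  have ha : 0 ≤ a := ha
  have hlin : γ * a + (γ + 1) < γ * b + (γ + 1) := by gcongr
  exact mul_lt_mul'' (Real.rpow_lt_rpow ha hab hγ) hlin (by positivity) (by positivity)

theorem exists_rpow_mul_linear_eq {γ : ℝ} (hγ : 1 ≤ γ) {c : ℝ} (hc : 0 < c) :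
    ∃ t : ℝ, 0 < t ∧ t ^ γ * (γ * t + (γ + 1)) = c := by
  have hγ0 : 0 < γ := by linarith
  have hcont : Continuous fun t : ℝ => t ^ γ * (γ * t + (γ + 1)) :=
    (continuous_id.rpow_const fun _ => Or.inr hγ0.le).mul (by fun_prop)
  have hlarge : c ≤ (1 + c) ^ γ * (γ * (1 + c) + (γ + 1)) := by
    have h1 : 1 ≤ (1 + c) ^ γ := Real.one_le_rpow (by linarith) hγ0.le
    have h2 : c ≤ γ * (1 + c) + (γ + 1) := by nlinarith
    exact h2.trans (le_mul_of_one_le_left (by positivity) h1)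
  obtain ⟨t, ht, hteq⟩ := intermediate_value_Icc (show (0 : ℝ) ≤ 1 + c by positivity)
    hcont.continuousOn ⟨by simpa [Real.zero_rpow hγ0.ne'] using hc.le, hlarge⟩
  refine ⟨t, lt_of_le_of_ne ht.1 ?_, hteq⟩
  rintro rfl
  simp [Real.zero_rpow hγ0.ne'] at hteq
  exact hc.ne hteq

/-- **Unique optimum of the variance factor for γ ≥ 1:** there is a unique P⋆ > 1 such
that g is strictly decreasing on (1, P⋆] and strictly increasing on [P⋆, ∞); in
particular P⋆ is the unique minimizer of g on (1, ∞). -/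
theorem gFun_unique_minimizer (ρ₀ β γ : ℝ) (hρ₀ : ρ₀ ∈ Set.Ico (0 : ℝ) 1)
    (hβ : 0 < β) (hγ : 1 ≤ γ) :
    ∃ Pstar : ℝ, 1 < Pstar ∧
      StrictAntiOn (gFun ρ₀ β γ) (Set.Ioc (1 : ℝ) Pstar) ∧
      StrictMonoOn (gFun ρ₀ β γ) (Set.Ici Pstar) ∧
      (∀ Q : ℝ, 1 < Q →
        StrictAntiOn (gFun ρ₀ β γ) (Set.Ioc (1 : ℝ) Q) →
        StrictMonoOn (gFun ρ₀ β γ) (Set.Ici Q) → Q = Pstar) ∧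
      (∀ P : ℝ, 1 < P → P ≠ Pstar → gFun ρ₀ β γ Pstar < gFun ρ₀ β γ P) := by
  have hγ0 : 0 < γ := by linarith
  obtain ⟨t, ht, hteq⟩ :=
    exists_rpow_mul_linear_eq hγ (div_pos (sub_pos.2 hρ₀.2) hβ)
  have hcrit : β * (t ^ γ * (γ * t + (γ + 1))) = 1 - ρ₀ := by
    rw [hteq, mul_div_cancel₀ _ hβ.ne']
  have hanti : StrictAntiOn (gFun ρ₀ β γ) (Set.Ioc 1 (1 + t)) := by
    refine strictAntiOn_of_deriv_neg (convex_Ioc _ _)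
      ((gFun_continuousOn ρ₀ β hγ0.le).mono fun x hx => one_pos.trans hx.1) fun x hx => ?_
    rw [interior_Ioc] at hx
    rw [(gFun_hasDerivAt ρ₀ β γ hx.1).deriv]
    have hlt := rpow_mul_linear_strictMonoOn hγ0 (Set.mem_Ici.2 (sub_pos.2 hx.1).le)
      (Set.mem_Ici.2 ht.le) (show x - 1 < t by linarith [hx.2])
    have := mul_lt_mul_of_pos_left hlt hβ
    exact div_neg_of_neg_of_pos (by linarith) (pow_pos (one_pos.trans hx.1) 2)
  have hmono : StrictMonoOn (gFun ρ₀ β γ) (Set.Ici (1 + t)) := by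
    refine strictMonoOn_of_deriv_pos (convex_Ici _)
      ((gFun_continuousOn ρ₀ β hγ0.le).mono fun x hx => ?_) fun x hx => ?_
    · exact lt_of_lt_of_le (by positivity) (Set.mem_Ici.1 hx)
    rw [interior_Ici] at hx
    have hx : 1 + t < x := hx
    have hx1 : 1 < x := by linarith
    rw [(gFun_hasDerivAt ρ₀ β γ hx1).deriv]
    have hlt := rpow_mul_linear_strictMonoOn hγ0 (Set.mem_Ici.2 ht.le)
      (Set.mem_Ici.2 (sub_pos.2 hx1).le) (show t < x - 1 by linarith)
    have := mul_lt_mul_of_pos_left hlt hβ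
    exact div_pos (by linarith) (pow_pos (one_pos.trans hx1) 2)
  have h1t : 1 < 1 + t := by linarith
  refine ⟨1 + t, h1t, hanti, hmono, fun Q hQ hQanti hQmono => ?_, fun P hP hne => ?_⟩
  · rcases lt_trichotomy Q (1 + t) with h | h | h
    · exact absurd (hanti ⟨hQ, h.le⟩ ⟨h1t, le_rfl⟩ h)
        (hQmono Set.self_mem_Ici (Set.mem_Ici.2 h.le) h).asymm
    · exact h
    · exact absurd (hQanti ⟨h1t, h.le⟩ ⟨hQ, le_rfl⟩ h)
        (hmono Set.self_mem_Ici (Set.mem_Ici.2 h.le) h).asymm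
  · rcases hne.lt_or_gt with h | h
    · exact hanti ⟨hP, h.le⟩ ⟨h1t, le_rfl⟩ h
    · exact hmono Set.self_mem_Ici (Set.mem_Ici.2 h.le) h
end
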